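/- Let m, ρ, F_c > 0, let F : [0,∞) → ℝ be locally integrable, and let (x₁,x₂,x₃) : [0,∞) → ℝ³ solve ẋ₁ = x₂, m·ẋ₂ = F(t) − x₃, ẋ₃ = ρ(1 − x₃/F_c)·max{0,x₂} + ρ(1 + x₃/F_c)·min{0,x₂}, with x₃(0) ∈ (−F_c,F_c). Then the function V(t) := (1/2)m x₂(t)² + H_D(x₃(t)) satisfies V̇(t) ≤ F(t)·x₂(t) for almost every t ≥ 0; i.e. the mass with Dahl friction is passive from the applied force F to the velocity x₂. -/

import Mathlib

open MeasureTheory Set Filter intervalIntegral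

noncomputable section

/-- The closed-form storage function of the Dahl model with `r = 1`. -/
def HD (ρ Fc σ : ℝ) : ℝ :=
  if 0 ≤ σ then Fc ^ 2 / ρ * Real.log (Fc / (σ + Fc)) + Fc / ρ * σ
  else Fc ^ 2 / ρ * Real.log (Fc / (Fc - σ)) - Fc / ρ * σ

/-- `(x₁,x₂,x₃)` solves on `[0,∞)` the forced mass with Dahl friction:
`ẋ₁ = x₂`, `m ẋ₂ = F(t) − x₃` (in integrated form, since `F` is merely locally
integrable), and `ẋ₃ = ρ(1 − x₃/F_c) max{0,x₂} + ρ(1 + x₃/F_c) min{0,x₂}`. -/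
def IsForcedMassDahlSol (m ρ Fc : ℝ) (Fext x₁ x₂ x₃ : ℝ → ℝ) : Prop :=
  (∀ t : ℝ, 0 ≤ t → HasDerivWithinAt x₁ (x₂ t) (Set.Ici 0) t) ∧
  (∀ t : ℝ, 0 ≤ t → x₂ t = x₂ 0 + ∫ s in (0:ℝ)..t, (Fext s - x₃ s) / m) ∧
  (∀ t : ℝ, 0 ≤ t →
    HasDerivWithinAt x₃
      (ρ * (1 - x₃ t / Fc) * max 0 (x₂ t) + ρ * (1 + x₃ t / Fc) * min 0 (x₂ t))
      (Set.Ici 0) t)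

theorem hasDerivAt_log_div_add {Fc x : ℝ} (ρ : ℝ) (hFc : 0 < Fc) (hx : 0 < x + Fc) :
    HasDerivAt (fun σ => Fc ^ 2 / ρ * Real.log (Fc / (σ + Fc)) + Fc / ρ * σ)
      (Fc / ρ * (x / (x + Fc))) x := by
  have h1 : HasDerivAt (fun σ => Fc / (σ + Fc)) (-Fc / (x + Fc) ^ 2) x := by
    simpa using (hasDerivAt_const x Fc).fun_div ((hasDerivAt_id' x).add_const Fc) hx.ne'
  have h2 := ((h1.log (div_pos hFc hx).ne').const_mul (Fc ^ 2 / ρ)).fun_add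
    ((hasDerivAt_id' x).const_mul (Fc / ρ))
  refine h2.congr_deriv ?_
  have := hx.ne'
  field_simp
  ring

theorem HD_of_nonneg {ρ Fc σ : ℝ} (h : 0 ≤ σ) :
    HD ρ Fc σ = Fc ^ 2 / ρ * Real.log (Fc / (σ + Fc)) + Fc / ρ * σ :=
  if_pos h

theorem HD_neg (ρ Fc σ : ℝ) : HD ρ Fc (-σ) = HD ρ Fc σ := by
  rcases lt_trichotomy σ 0 with h | rfl | h
  · rw [HD, HD, if_pos (by linarith), if_neg (by linarith), neg_add_eq_sub]
    ring
  · simp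
  · rw [HD, HD, if_neg (by linarith), if_pos h.le, sub_neg_eq_add, add_comm Fc]
    ring

theorem hasDerivWithinAt_HD_Ici {Fc x : ℝ} (ρ : ℝ) (hFc : 0 < Fc) (hx : 0 ≤ x) :
    HasDerivWithinAt (HD ρ Fc) (Fc / ρ * (x / (|x| + Fc))) (Ici 0) x := by
  rw [abs_of_nonneg hx]
  exact (hasDerivAt_log_div_add ρ hFc (by linarith)).hasDerivWithinAt.congr
    (fun σ hσ => HD_of_nonneg hσ) (HD_of_nonneg hx)

theorem hasDerivWithinAt_HD_Iic {Fc x : ℝ} (ρ : ℝ) (hFc : 0 < Fc) (hx : x ≤ 0) :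
    HasDerivWithinAt (HD ρ Fc) (Fc / ρ * (x / (|x| + Fc))) (Iic 0) x := by
  have h := (hasDerivWithinAt_HD_Ici ρ hFc (neg_nonneg.2 hx)).scomp x
    (hasDerivAt_neg x).hasDerivWithinAt
    (fun σ (hσ : σ ∈ Iic 0) => mem_Ici.2 (neg_nonneg.2 hσ))
  refine (h.congr (fun σ _ => (HD_neg ρ Fc σ).symm) (HD_neg ρ Fc x).symm).congr_deriv ?_
  rw [abs_neg, smul_eq_mul]
  ring

theorem hasDerivAt_HD {Fc : ℝ} (ρ : ℝ) (hFc : 0 < Fc) (x : ℝ) :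
    HasDerivAt (HD ρ Fc) (Fc / ρ * (x / (|x| + Fc))) x := by
  rcases lt_trichotomy x 0 with h | rfl | h
  · exact (hasDerivWithinAt_HD_Iic ρ hFc h.le).hasDerivAt (Iic_mem_nhds h)
  · simpa [Iic_union_Ici] using
      (hasDerivWithinAt_HD_Iic ρ hFc le_rfl).union (hasDerivWithinAt_HD_Ici ρ hFc le_rfl)
  · exact (hasDerivWithinAt_HD_Ici ρ hFc h.le).hasDerivAt (Ici_mem_nhds h)

/-- Passivity of the Dahl model: along its flow the storage function grows at most at the
rate `σ * v` of supplied power. -/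
theorem HD_deriv_mul_dahl_le {ρ Fc : ℝ} (hρ : 0 < ρ) (hFc : 0 < Fc) (σ v : ℝ) :
    Fc / ρ * (σ / (|σ| + Fc)) *
      (ρ * (1 - σ / Fc) * max 0 v + ρ * (1 + σ / Fc) * min 0 v) ≤ σ * v := by
  have hpos : 0 < |σ| + Fc := by positivity
  have key : Fc / ρ * (σ / (|σ| + Fc)) *
      (ρ * (1 - σ / Fc) * max 0 v + ρ * (1 + σ / Fc) * min 0 v) =
      σ * ((Fc - σ) * max 0 v + (Fc + σ) * min 0 v) / (|σ| + Fc) := by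
    field_simp
  rw [key, div_le_iff₀ hpos]
  rcases le_total 0 v with hv | hv
  · rw [max_eq_right hv, min_eq_left hv]
    rcases abs_cases σ with ⟨h, -⟩ | ⟨h, -⟩ <;> rw [h] <;>
      nlinarith [mul_nonneg (sq_nonneg σ) hv]
  · rw [max_eq_left hv, min_eq_right hv]
    rcases abs_cases σ with ⟨h, -⟩ | ⟨h, -⟩ <;> rw [h] <;>
      nlinarith [mul_nonneg (sq_nonneg σ) (neg_nonneg.2 hv)]

theorem ae_hasDerivWithinAt_of_eq_integral {x g : ℝ → ℝ} (hg : LocallyIntegrableOn g (Ici 0))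
    (hx : ∀ t, 0 ≤ t → x t = x 0 + ∫ s in (0 : ℝ)..t, g s) :
    ∀ᵐ t : ℝ, 0 ≤ t → HasDerivWithinAt x (g t) (Ici 0) t := by
  have hint (n : ℕ) : IntervalIntegrable g volume 0 n :=
    (intervalIntegrable_iff_integrableOn_Icc_of_le n.cast_nonneg).2
      (hg.integrableOn_compact_subset Icc_subset_Ici_self isCompact_Icc)
  filter_upwards [ae_all_iff.2 fun n => (hint n).ae_hasDerivAt_integral] with t ht ht0
  obtain ⟨n, hn⟩ := exists_nat_ge t
  have h := ht n (by rw [uIcc_of_le n.cast_nonneg]; exact ⟨ht0, hn⟩) 0 left_mem_uIcc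
  exact (h.const_add (x 0)).hasDerivWithinAt.congr hx (hx t ht0)

/-- the mass with Dahl friction is passive from the applied force `F` to
the velocity `x₂`: `V = ½mx₂² + H_D(x₃)` satisfies `V̇(t) ≤ F(t)·x₂(t)` for a.e. `t ≥ 0`. -/
theorem forced_mass_dahl_passive (m ρ Fc : ℝ)
    (hm : 0 < m) (hρ : 0 < ρ) (hFc : 0 < Fc)
    (Fext x₁ x₂ x₃ : ℝ → ℝ)
    (hF : MeasureTheory.LocallyIntegrableOn Fext (Set.Ici 0))
    (hsol : IsForcedMassDahlSol m ρ Fc Fext x₁ x₂ x₃)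
    (hx₃0 : x₃ 0 ∈ Set.Ioo (-Fc) Fc) :
    ∀ᵐ t : ℝ, 0 ≤ t → ∃ D : ℝ,
      HasDerivWithinAt (fun s => 1 / 2 * m * (x₂ s) ^ 2 + HD ρ Fc (x₃ s))
        D (Set.Ici 0) t ∧
      D ≤ Fext t * x₂ t := by
  obtain ⟨-, h₂, h₃⟩ := hsol
  have hx₃ : LocallyIntegrableOn x₃ (Ici 0) :=
    ContinuousOn.locallyIntegrableOn (fun t ht => (h₃ t ht).continuousWithinAt) measurableSet_Ici
  have hg : LocallyIntegrableOn (fun s => (Fext s - x₃ s) / m) (Ici 0) := by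
    simpa [div_eq_inv_mul, Pi.smul_def] using (hF.sub hx₃).smul m⁻¹
  filter_upwards [ae_hasDerivWithinAt_of_eq_integral hg h₂] with t ht ht0
  refine ⟨_, (((ht ht0).fun_pow 2).const_mul (1 / 2 * m)).fun_add
    ((hasDerivAt_HD ρ hFc (x₃ t)).comp_hasDerivWithinAt t (h₃ t ht0)), ?_⟩
  have hpower : 1 / 2 * m * ((2 : ℕ) * x₂ t ^ (2 - 1) * ((Fext t - x₃ t) / m)) =
      x₂ t * (Fext t - x₃ t) := by
    field_simp
    push_cast
    ring
  rw [hpower]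
  linarith [HD_deriv_mul_dahl_le hρ hFc (x₃ t) (x₂ t)]
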